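/- There exists an absolute constant C > 0 with the following property. Let w be a weight on [0,1) with dyadic A₂ characteristic [w]_{A₂} = Q < ∞, and suppose the testing condition holds with constant q > 0: (1/|J|) Σ_{I ∈ D(J)} γ_I |I| ≤ q² ⟨w^{-1}⟩_J for every dyadic interval J, where γ_I = (Δ_I w^{-1})² ⟨w⟩_I. Then for every measurable φ with ∫_0^1 φ² w^{-1} dx < ∞, one has ‖S(φ w^{-1})‖_{L²(w)} ≤ C (Q^{1/2} + q) ‖φ‖_{L²(w^{-1})}. -/

import Mathlib

open MeasureTheory

noncomputable section

/-- The dyadic interval `[k/2^n, (k+1)/2^n)`. -/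
def dyadicI (n k : ℕ) : Set ℝ := Set.Ico ((k : ℝ) / 2 ^ n) (((k : ℝ) + 1) / 2 ^ n)

/-- The length of a dyadic interval of generation `n`. -/
def dyadicLen (n : ℕ) : ℝ := 1 / 2 ^ n

/-- The average `⟨f⟩_I` of `f` over the dyadic interval `I = (n,k)`. -/
def avg (f : ℝ → ℝ) (n k : ℕ) : ℝ := (2 : ℝ) ^ n * ∫ x in dyadicI n k, f x

/-- The martingale difference `Δ_I f = ⟨f⟩_{I₊} - ⟨f⟩_{I₋}` for `I = (n,k)`. -/
def haarDiff (f : ℝ → ℝ) (n k : ℕ) : ℝ :=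
  avg f (n + 1) (2 * k + 1) - avg f (n + 1) (2 * k)

/-- `γ_I = (Δ_I w⁻¹)² ⟨w⟩_I` for `I = (n,k)`. -/
def gammaI (w : ℝ → ℝ) (n k : ℕ) : ℝ :=
  (haarDiff (fun x => (w x)⁻¹) n k) ^ 2 * avg w n k

/-- The sum of `g` over the first `N` generations below `(n, k)`, normalised by the length
of `(n, k)`. -/
def treeSum (g : ℕ → ℕ → ℝ) : ℕ → ℕ → ℕ → ℝ
  | 0, _, _ => 0
  | N + 1, n, k =>
      g n k + (treeSum g N (n + 1) (2 * k) + treeSum g N (n + 1) (2 * k + 1)) / 2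

theorem treeSum_nonneg {g : ℕ → ℕ → ℝ} (hg : ∀ n k, k < 2 ^ n → 0 ≤ g n k) (N : ℕ) :
    ∀ n k, k < 2 ^ n → 0 ≤ treeSum g N n k := by
  induction N with
  | zero => intro n k _; simp [treeSum]
  | succ N ih =>
    intro n k hk
    have hl := ih (n + 1) (2 * k) (by rw [pow_succ]; omega)
    have hr := ih (n + 1) (2 * k + 1) (by rw [pow_succ]; omega)
    have := hg n k hk
    simp only [treeSum]
    linarith

theorem sum_generations_eq_treeSum (g : ℕ → ℕ → ℝ) (N : ℕ) : ∀ n k,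
    ∑ p ∈ Finset.range N, ∑ r ∈ Finset.range (2 ^ p),
      g (n + p) (2 ^ p * k + r) * dyadicLen (n + p) = dyadicLen n * treeSum g N n k := by
  induction N with
  | zero => intro n k; simp [treeSum]
  | succ N ih =>
    intro n k
    have hsplit : ∀ p, ∑ r ∈ Finset.range (2 ^ (p + 1)),
        g (n + (p + 1)) (2 ^ (p + 1) * k + r) * dyadicLen (n + (p + 1)) =
        ∑ r ∈ Finset.range (2 ^ p),
          g (n + 1 + p) (2 ^ p * (2 * k) + r) * dyadicLen (n + 1 + p) +
        ∑ r ∈ Finset.range (2 ^ p),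
          g (n + 1 + p) (2 ^ p * (2 * k + 1) + r) * dyadicLen (n + 1 + p) := by
      intro p
      rw [show 2 ^ (p + 1) = 2 ^ p + 2 ^ p by ring, Finset.sum_range_add,
        show n + (p + 1) = n + 1 + p by ring]
      congr 1 <;> refine Finset.sum_congr rfl fun r _ => ?_ <;> congr 2 <;> ring
    rw [Finset.sum_range_succ', Finset.sum_congr rfl fun p _ => hsplit p,
      Finset.sum_add_distrib, ih, ih]
    simp only [treeSum, pow_zero, Finset.sum_range_one, dyadicLen, pow_succ, add_zero, one_mul]
    field_simp
    ring

theorem dyadicI_eq_union (n k : ℕ) :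
    dyadicI n k = dyadicI (n + 1) (2 * k) ∪ dyadicI (n + 1) (2 * k + 1) := by
  unfold dyadicI
  rw [show (((2 * k + 1 : ℕ) : ℝ)) = ((2 * k : ℕ) : ℝ) + 1 by push_cast; ring,
    Set.Ico_union_Ico_eq_Ico (by gcongr; linarith) (by gcongr; linarith)]
  congr 1 <;> push_cast <;> rw [pow_succ] <;> field_simp
  ring

theorem disjoint_dyadicI_children (n k : ℕ) :
    Disjoint (dyadicI (n + 1) (2 * k)) (dyadicI (n + 1) (2 * k + 1)) := by
  unfold dyadicI
  rw [show (((2 * k + 1 : ℕ) : ℝ)) = ((2 * k : ℕ) : ℝ) + 1 by push_cast; ring]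
  exact Set.Ico_disjoint_Ico_same

theorem dyadicI_subset {n k : ℕ} (hk : k < 2 ^ n) : dyadicI n k ⊆ Set.Ico (0 : ℝ) 1 := by
  have hk' : (k : ℝ) + 1 ≤ 2 ^ n := by exact_mod_cast hk
  apply Set.Ico_subset_Ico
  · positivity
  · rw [div_le_one (by positivity)]
    exact hk'

theorem avg_eq_half_add {f : ℝ → ℝ} (hf : IntegrableOn f (Set.Ico (0 : ℝ) 1)) {n k : ℕ}
    (hk : k < 2 ^ n) :
    avg f n k = (avg f (n + 1) (2 * k) + avg f (n + 1) (2 * k + 1)) / 2 := by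
  have hl : dyadicI (n + 1) (2 * k) ⊆ Set.Ico (0 : ℝ) 1 :=
    dyadicI_subset (by rw [pow_succ]; omega)
  have hr : dyadicI (n + 1) (2 * k + 1) ⊆ Set.Ico (0 : ℝ) 1 :=
    dyadicI_subset (by rw [pow_succ]; omega)
  unfold avg
  rw [dyadicI_eq_union n k, setIntegral_union (disjoint_dyadicI_children n k) measurableSet_Ico
    (hf.mono_set hl) (hf.mono_set hr), pow_succ]
  ring

theorem avg_nonneg {f : ℝ → ℝ} (hf : ∀ x ∈ Set.Ico (0 : ℝ) 1, 0 ≤ f x) {n k : ℕ}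
    (hk : k < 2 ^ n) : 0 ≤ avg f n k :=
  mul_nonneg (by positivity)
    (setIntegral_nonneg measurableSet_Ico fun x hx => hf x (dyadicI_subset hk hx))

theorem avg_pos {f : ℝ → ℝ} (hf : ∀ x ∈ Set.Ico (0 : ℝ) 1, 0 < f x)
    (hi : IntegrableOn f (Set.Ico (0 : ℝ) 1)) {n k : ℕ} (hk : k < 2 ^ n) : 0 < avg f n k := by
  refine mul_pos (by positivity) ?_
  have hlt : (k : ℝ) / 2 ^ n < ((k : ℝ) + 1) / 2 ^ n := by gcongr; linarith
  rw [setIntegral_pos_iff_support_of_nonneg_ae]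
  · have hsub : dyadicI n k ⊆ Function.support f ∩ dyadicI n k :=
      fun x hx => ⟨(hf x (dyadicI_subset hk hx)).ne', hx⟩
    refine lt_of_lt_of_le ?_ (measure_mono hsub)
    rw [dyadicI, Real.volume_Ico]
    simpa using hlt
  · filter_upwards [ae_restrict_mem measurableSet_Ico] with x hx
    exact (hf x (dyadicI_subset hk hx)).le
  · exact hi.mono_set (dyadicI_subset hk)

theorem integrableOn_mul_of_sq_mul {φ v : ℝ → ℝ} (hφ : Measurable φ) (hv : Measurable v)
    {s : Set ℝ} (hs : MeasurableSet s) (hpos : ∀ x ∈ s, 0 < v x)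
    (hvi : IntegrableOn v s) (hφi : IntegrableOn (fun x => φ x ^ 2 * v x) s) :
    IntegrableOn (fun x => φ x * v x) s := by
  refine Integrable.mono' (hφi.add hvi) (hφ.mul hv).aestronglyMeasurable ?_
  filter_upwards [ae_restrict_mem hs] with x hx
  have hv0 := hpos x hx
  simp only [Pi.add_apply, Real.norm_eq_abs, abs_mul, abs_of_pos hv0]
  have h : |φ x| ≤ φ x ^ 2 + 1 := by
    nlinarith [sq_abs (φ x), sq_nonneg (|φ x| - 1), abs_nonneg (φ x)]
  nlinarith

theorem avg_mul_sq_div_le {φ v : ℝ → ℝ} (hφ : Measurable φ) (hv : Measurable v)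
    (hpos : ∀ x ∈ Set.Ico (0 : ℝ) 1, 0 < v x) (hvi : IntegrableOn v (Set.Ico (0 : ℝ) 1))
    (hφi : IntegrableOn (fun x => φ x ^ 2 * v x) (Set.Ico (0 : ℝ) 1)) {n k : ℕ}
    (hk : k < 2 ^ n) :
    avg (fun x => φ x * v x) n k ^ 2 / avg v n k ≤ avg (fun x => φ x ^ 2 * v x) n k := by
  have hφv := integrableOn_mul_of_sq_mul hφ hv measurableSet_Ico hpos hvi hφi
  have hsub := dyadicI_subset hk
  have key (t : ℝ) : 0 ≤ avg (fun x => φ x ^ 2 * v x) n k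
      - 2 * t * avg (fun x => φ x * v x) n k + t ^ 2 * avg v n k := by
    have h := avg_nonneg (f := fun x => (φ x - t) ^ 2 * v x)
      (fun x hx => mul_nonneg (sq_nonneg _) (hpos x hx).le) hk
    have e : (fun x => (φ x - t) ^ 2 * v x) = fun x =>
        φ x ^ 2 * v x - 2 * t * (φ x * v x) + t ^ 2 * v x := by
      funext x; ring
    rw [e] at h
    unfold avg at h ⊢
    have hi₁ : IntegrableOn (fun x => φ x ^ 2 * v x) (dyadicI n k) := hφi.mono_set hsub
    have hi₂ : IntegrableOn (fun x => 2 * t * (φ x * v x)) (dyadicI n k) :=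
      (hφv.mono_set hsub).const_mul _
    have hi₃ : IntegrableOn (fun x => t ^ 2 * v x) (dyadicI n k) :=
      (hvi.mono_set hsub).const_mul _
    have hi₁₂ : IntegrableOn (fun x => φ x ^ 2 * v x - 2 * t * (φ x * v x)) (dyadicI n k) :=
      hi₁.sub hi₂
    rw [integral_add hi₁₂ hi₃, integral_sub hi₁ hi₂, integral_const_mul,
      integral_const_mul] at h
    linarith
  have hs := avg_pos hpos hvi hk
  have h := key (avg (fun x => φ x * v x) n k / avg v n k)
  generalize avg (fun x => φ x * v x) n k = f at *
  generalize avg v n k = s at *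
  have e : 2 * (f / s) * f = 2 * (f ^ 2 / s) := by ring
  have e' : (f / s) ^ 2 * s = f ^ 2 / s := by field_simp
  rw [e, e'] at h
  linarith

theorem sq_mean_div_le (x y : ℝ) {a b : ℝ} (ha : 0 < a) (hb : 0 < b) :
    ((x + y) / 2) ^ 2 / ((a + b) / 2) ≤ (x ^ 2 / a + y ^ 2 / b) / 2 := by
  have e : (x ^ 2 / a + y ^ 2 / b) / 2 - ((x + y) / 2) ^ 2 / ((a + b) / 2) =
      (x * b - y * a) ^ 2 / (2 * a * b * (a + b)) := by
    field_simp
    ring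
  have : 0 ≤ (x * b - y * a) ^ 2 / (2 * a * b * (a + b)) := by positivity
  linarith

/-- Main inequality for the Bellman function of the weighted Carleson embedding theorem. -/
theorem carleson_bellman_step {f₁ f₂ s₁ s₂ u₁ u₂ a : ℝ} (hs₁ : 0 < s₁) (hs₂ : 0 < s₂)
    (hu₁ : 0 < u₁) (hu₂ : 0 < u₂) (ha : 0 ≤ a)
    (hu : a + (u₁ + u₂) / 2 ≤ 2 * ((s₁ + s₂) / 2)) :
    ((f₁ + f₂) / 2 / ((s₁ + s₂) / 2)) ^ 2 * a ≤
      4 * ((f₁ ^ 2 / u₁ + f₂ ^ 2 / u₂) / 2 - ((f₁ + f₂) / 2) ^ 2 / (a + (u₁ + u₂) / 2)) := by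
  have hc := sq_mean_div_le f₁ f₂ hu₁ hu₂
  have hv : 0 < (u₁ + u₂) / 2 := by positivity
  have hs : 0 < (s₁ + s₂) / 2 := by positivity
  generalize (u₁ + u₂) / 2 = v at *
  generalize (s₁ + s₂) / 2 = s at *
  generalize (f₁ + f₂) / 2 = f at *
  have e : f ^ 2 / v - f ^ 2 / (a + v) = f ^ 2 * a / (v * (a + v)) := by
    field_simp
    ring
  have hle : f ^ 2 * a / (4 * s ^ 2) ≤ f ^ 2 * a / (v * (a + v)) := by
    apply div_le_div_of_nonneg_left (by positivity) (by positivity)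
    nlinarith
  have e' : (f / s) ^ 2 * a = 4 * (f ^ 2 * a / (4 * s ^ 2)) := by field_simp
  linarith

/-- The weighted martingale difference is controlled by the increment of `f ^ 2 / s`. -/
theorem sq_weighted_diff_le (f₁ f₂ : ℝ) {s₁ s₂ : ℝ} (hs₁ : 0 < s₁) (hs₂ : 0 < s₂) :
    (f₂ - f₁ - (f₁ + f₂) / 2 / ((s₁ + s₂) / 2) * (s₂ - s₁)) ^ 2 ≤
      4 * ((s₁ + s₂) / 2) *
        ((f₁ ^ 2 / s₁ + f₂ ^ 2 / s₂) / 2 - ((f₁ + f₂) / 2) ^ 2 / ((s₁ + s₂) / 2)) := by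
  have e₁ : (f₂ - f₁ - (f₁ + f₂) / 2 / ((s₁ + s₂) / 2) * (s₂ - s₁)) ^ 2 =
      (f₁ * s₂ - f₂ * s₁) ^ 2 / ((s₁ + s₂) ^ 2 / 4) := by
    field_simp
    ring
  have e₂ : 4 * ((s₁ + s₂) / 2) *
      ((f₁ ^ 2 / s₁ + f₂ ^ 2 / s₂) / 2 - ((f₁ + f₂) / 2) ^ 2 / ((s₁ + s₂) / 2)) =
      (f₁ * s₂ - f₂ * s₁) ^ 2 / (s₁ * s₂) := by
    field_simp
    ring
  rw [e₁, e₂]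
  apply div_le_div_of_nonneg_left (by positivity) (by positivity)
  nlinarith [sq_nonneg (s₁ - s₂)]

theorem sq_diff_mul_le {f₁ f₂ s₁ s₂ u₁ u₂ q Q W γ : ℝ} (hs₁ : 0 < s₁) (hs₂ : 0 < s₂)
    (hu₁ : 0 < u₁) (hu₂ : 0 < u₂) (hq : 0 < q) (hW : 0 ≤ W) (hQ : W * ((s₁ + s₂) / 2) ≤ Q)
    (hγ : γ = (s₂ - s₁) ^ 2 * W)
    (hu : γ / q ^ 2 + (u₁ + u₂) / 2 ≤ 2 * ((s₁ + s₂) / 2)) :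
    (f₂ - f₁) ^ 2 * W ≤
      8 * q ^ 2 * ((f₁ ^ 2 / u₁ + f₂ ^ 2 / u₂) / 2 -
        ((f₁ + f₂) / 2) ^ 2 / (γ / q ^ 2 + (u₁ + u₂) / 2)) +
      8 * Q * ((f₁ ^ 2 / s₁ + f₂ ^ 2 / s₂) / 2 - ((f₁ + f₂) / 2) ^ 2 / ((s₁ + s₂) / 2)) := by
  have hγ0 : 0 ≤ γ := by rw [hγ]; positivity
  have h₁ := carleson_bellman_step (f₁ := f₁) (f₂ := f₂) hs₁ hs₂ hu₁ hu₂
    (a := γ / q ^ 2) (by positivity) hu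
  have h₂ := sq_weighted_diff_le f₁ f₂ hs₁ hs₂
  have h₃ := sub_nonneg.2 (sq_mean_div_le f₁ f₂ hs₁ hs₂)
  generalize ((f₁ ^ 2 / u₁ + f₂ ^ 2 / u₂) / 2 -
        ((f₁ + f₂) / 2) ^ 2 / (γ / q ^ 2 + (u₁ + u₂) / 2)) = A at *
  generalize ((f₁ ^ 2 / s₁ + f₂ ^ 2 / s₂) / 2 - ((f₁ + f₂) / 2) ^ 2 / ((s₁ + s₂) / 2)) = B at *
  generalize (f₁ + f₂) / 2 / ((s₁ + s₂) / 2) = m at *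
  have h₁' : m ^ 2 * γ ≤ 4 * q ^ 2 * A := by
    have := mul_le_mul_of_nonneg_right h₁ (sq_nonneg q)
    have e : m ^ 2 * (γ / q ^ 2) * q ^ 2 = m ^ 2 * γ := by field_simp
    linarith
  have h₂' := mul_le_mul_of_nonneg_right h₂ hW
  have h₃' := mul_le_mul_of_nonneg_right hQ h₃
  have h₄ : (f₂ - f₁) ^ 2 * W ≤
      2 * (m ^ 2 * γ) + 2 * ((f₂ - f₁ - m * (s₂ - s₁)) ^ 2 * W) := by
    rw [hγ]
    nlinarith [mul_nonneg (sq_nonneg (f₂ - f₁ - 2 * (m * (s₂ - s₁)))) hW]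
  linarith

/-- Bellman induction over the tree of dyadic intervals: `f`, `s`, `F`, `W` stand for the averages
of `φ w⁻¹`, `w⁻¹`, `φ² w⁻¹` and `w`. -/
theorem treeSum_sq_diff_le {f s F W γ : ℕ → ℕ → ℝ} {q Q : ℝ} (hq : 0 < q)
    (hs : ∀ n k, k < 2 ^ n → 0 < s n k) (hW : ∀ n k, k < 2 ^ n → 0 ≤ W n k)
    (hQ : ∀ n k, k < 2 ^ n → W n k * s n k ≤ Q)
    (hf2 : ∀ n k, k < 2 ^ n → f n k = (f (n + 1) (2 * k) + f (n + 1) (2 * k + 1)) / 2)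
    (hs2 : ∀ n k, k < 2 ^ n → s n k = (s (n + 1) (2 * k) + s (n + 1) (2 * k + 1)) / 2)
    (hF2 : ∀ n k, k < 2 ^ n → F n k = (F (n + 1) (2 * k) + F (n + 1) (2 * k + 1)) / 2)
    (hF : ∀ n k, k < 2 ^ n → f n k ^ 2 / s n k ≤ F n k)
    (hγ : ∀ n k, γ n k = (s (n + 1) (2 * k + 1) - s (n + 1) (2 * k)) ^ 2 * W n k)
    (htest : ∀ n k, k < 2 ^ n → ∀ N, treeSum γ N n k ≤ q ^ 2 * s n k) (N : ℕ) :
    ∀ n k, k < 2 ^ n →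
      treeSum (fun n k => (f (n + 1) (2 * k + 1) - f (n + 1) (2 * k)) ^ 2 * W n k) N n k ≤
        8 * q ^ 2 * (F n k - f n k ^ 2 / (s n k + treeSum γ N n k / q ^ 2)) +
        8 * Q * (F n k - f n k ^ 2 / s n k) := by
  have hγ0 : ∀ n k, k < 2 ^ n → 0 ≤ γ n k := fun n k hk => by
    rw [hγ]; exact mul_nonneg (sq_nonneg _) (hW n k hk)
  have hM := treeSum_nonneg hγ0
  induction N with
  | zero =>
    intro n k hk
    have hQ0 : 0 ≤ Q := (mul_nonneg (hW n k hk) (hs n k hk).le).trans (hQ n k hk)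
    have := sub_nonneg.2 (hF n k hk)
    simp only [treeSum, zero_div, add_zero]
    positivity
  | succ N ih =>
    intro n k hk
    have hkl : 2 * k < 2 ^ (n + 1) := by rw [pow_succ]; omega
    have hkr : 2 * k + 1 < 2 ^ (n + 1) := by rw [pow_succ]; omega
    have hul : 0 < s (n + 1) (2 * k) + treeSum γ N (n + 1) (2 * k) / q ^ 2 :=
      add_pos_of_pos_of_nonneg (hs _ _ hkl) (div_nonneg (hM N _ _ hkl) (sq_nonneg q))
    have hur : 0 < s (n + 1) (2 * k + 1) + treeSum γ N (n + 1) (2 * k + 1) / q ^ 2 :=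
      add_pos_of_pos_of_nonneg (hs _ _ hkr) (div_nonneg (hM N _ _ hkr) (sq_nonneg q))
    have hQ' := hQ n k hk
    have ht : treeSum γ (N + 1) n k / q ^ 2 ≤ s n k := by
      rw [div_le_iff₀ (by positivity)]
      linarith [htest n k hk (N + 1)]
    have e : s n k + treeSum γ (N + 1) n k / q ^ 2 = γ n k / q ^ 2 +
        ((s (n + 1) (2 * k) + treeSum γ N (n + 1) (2 * k) / q ^ 2) +
          (s (n + 1) (2 * k + 1) + treeSum γ N (n + 1) (2 * k + 1) / q ^ 2)) / 2 := by
      rw [hs2 n k hk]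
      simp only [treeSum]
      ring
    have hu : s n k + treeSum γ (N + 1) n k / q ^ 2 ≤ 2 * s n k := by linarith
    rw [e, hs2 n k hk] at hu
    rw [hs2 n k hk] at hQ'
    have step := sq_diff_mul_le (f₁ := f (n + 1) (2 * k)) (f₂ := f (n + 1) (2 * k + 1))
      (hs _ _ hkl) (hs _ _ hkr) hul hur hq (hW n k hk) hQ' (hγ n k) hu
    rw [e, hs2 n k hk, hf2 n k hk, hF2 n k hk, treeSum]
    linarith [ih _ _ hkl, ih _ _ hkr]

/-- there is an absolute constant `C > 0` such that if `w` is a weight on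
`[0,1)` with `[w]_{A₂} ≤ Q` and the testing condition
`(1/|J|) Σ_{I ∈ D(J)} γ_I |I| ≤ q² ⟨w⁻¹⟩_J` holds for all dyadic `J` (with `q > 0`,
`γ_I = (Δ_I w⁻¹)² ⟨w⟩_I`), then for every `φ ∈ L²(w⁻¹)` one has
`‖S(φ w⁻¹)‖_{L²(w)} ≤ C (Q^{1/2} + q) ‖φ‖_{L²(w⁻¹)}`; the squared `L²(w)` norm of
`S(φ w⁻¹)` equals `Σ_{I ∈ 𝒟} (Δ_I (φ w⁻¹))² ⟨w⟩_I |I|` and is expressed through all its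
finite partial sums over generations `p < N`. -/
theorem improved_T1_estimate :
    ∃ C : ℝ, 0 < C ∧
      ∀ w : ℝ → ℝ, Measurable w →
        (∀ x ∈ Set.Ico (0 : ℝ) 1, 0 < w x) →
        IntegrableOn w (Set.Ico (0 : ℝ) 1) →
        IntegrableOn (fun x => (w x)⁻¹) (Set.Ico (0 : ℝ) 1) →
        ∀ Q : ℝ,
          (∀ n k : ℕ, k < 2 ^ n →
            avg w n k * avg (fun x => (w x)⁻¹) n k ≤ Q) →
        ∀ q : ℝ, 0 < q →
          (∀ n k : ℕ, k < 2 ^ n → ∀ N : ℕ,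
            (1 / dyadicLen n) *
              ∑ p ∈ Finset.range N, ∑ r ∈ Finset.range (2 ^ p),
                gammaI w (n + p) (2 ^ p * k + r) * dyadicLen (n + p)
            ≤ q ^ 2 * avg (fun x => (w x)⁻¹) n k) →
        ∀ φ : ℝ → ℝ, Measurable φ →
          IntegrableOn (fun x => φ x ^ 2 * (w x)⁻¹) (Set.Ico (0 : ℝ) 1) →
        ∀ N : ℕ,
          ∑ p ∈ Finset.range N, ∑ r ∈ Finset.range (2 ^ p),
              (haarDiff (fun x => φ x * (w x)⁻¹) p r) ^ 2 * avg w p r * dyadicLen p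
            ≤ C ^ 2 * (Real.sqrt Q + q) ^ 2 *
                ∫ x in Set.Ico (0 : ℝ) 1, φ x ^ 2 * (w x)⁻¹ := by
  refine ⟨3, by norm_num, ?_⟩
  intro w hw hpos hwi hvi Q hQ q hq htest φ hφ hφi N
  have hvpos : ∀ x ∈ Set.Ico (0 : ℝ) 1, 0 < (w x)⁻¹ := fun x hx => inv_pos.2 (hpos x hx)
  have hφv := integrableOn_mul_of_sq_mul hφ hw.inv measurableSet_Ico hvpos hvi hφi
  have hlen (n : ℕ) : 0 < dyadicLen n := by unfold dyadicLen; positivity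
  have hF0 : 0 ≤ avg (fun x => φ x ^ 2 * (w x)⁻¹) 0 0 :=
    avg_nonneg (fun x hx => mul_nonneg (sq_nonneg _) (hvpos x hx).le) (by norm_num)
  have hs0 : 0 < avg (fun x => (w x)⁻¹) 0 0 := avg_pos hvpos hvi (by norm_num)
  have hQ0 : 0 ≤ Q := (mul_nonneg (avg_nonneg (fun x hx => (hpos x hx).le) (by norm_num))
    hs0.le).trans (hQ 0 0 (by norm_num))
  have hγ0 : ∀ n k, k < 2 ^ n → 0 ≤ gammaI w n k := fun n k hk =>
    mul_nonneg (sq_nonneg _) (avg_nonneg (fun x hx => (hpos x hx).le) hk)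
  have htree : ∀ n k, k < 2 ^ n → ∀ N,
      treeSum (gammaI w) N n k ≤ q ^ 2 * avg (fun x => (w x)⁻¹) n k := by
    intro n k hk N
    have h := htest n k hk N
    rwa [sum_generations_eq_treeSum, ← mul_assoc, one_div,
      inv_mul_cancel₀ (hlen n).ne', one_mul] at h
  have main := treeSum_sq_diff_le (f := avg fun x => φ x * (w x)⁻¹)
    (s := avg fun x => (w x)⁻¹) (F := avg fun x => φ x ^ 2 * (w x)⁻¹) (W := avg w)
    (γ := gammaI w) hq (fun n k hk => avg_pos hvpos hvi hk)
    (fun n k hk => avg_nonneg (fun x hx => (hpos x hx).le) hk) hQ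
    (fun n k hk => avg_eq_half_add hφv hk) (fun n k hk => avg_eq_half_add hvi hk)
    (fun n k hk => avg_eq_half_add hφi hk)
    (fun n k hk => avg_mul_sq_div_le hφ hw.inv hvpos hvi hφi hk) (fun _ _ => rfl) htree N
    0 0 (by norm_num)
  have hsum := sum_generations_eq_treeSum
    (fun n k => haarDiff (fun x => φ x * (w x)⁻¹) n k ^ 2 * avg w n k) N 0 0
  simp only [zero_add, mul_zero] at hsum
  rw [hsum, show dyadicLen 0 = 1 by simp [dyadicLen], one_mul]
  have hF : avg (fun x => φ x ^ 2 * (w x)⁻¹) 0 0 =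
      ∫ x in Set.Ico (0 : ℝ) 1, φ x ^ 2 * (w x)⁻¹ := by
    simp [avg, dyadicI]
  rw [← hF]
  have h₁ : 0 ≤ avg (fun x => φ x * (w x)⁻¹) 0 0 ^ 2 /
      (avg (fun x => (w x)⁻¹) 0 0 + treeSum (gammaI w) N 0 0 / q ^ 2) := by
    have := treeSum_nonneg hγ0 N 0 0 (by norm_num)
    positivity
  have h₂ : 0 ≤ avg (fun x => φ x * (w x)⁻¹) 0 0 ^ 2 / avg (fun x => (w x)⁻¹) 0 0 := by
    positivity
  refine main.trans ?_
  calc _ ≤ 8 * q ^ 2 * avg (fun x => φ x ^ 2 * (w x)⁻¹) 0 0 +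
        8 * Q * avg (fun x => φ x ^ 2 * (w x)⁻¹) 0 0 := by
        gcongr <;> linarith
    _ = 8 * (q ^ 2 + √Q ^ 2) * avg (fun x => φ x ^ 2 * (w x)⁻¹) 0 0 := by
        rw [Real.sq_sqrt hQ0]; ring
    _ ≤ _ := by
        refine mul_le_mul_of_nonneg_right ?_ hF0
        nlinarith [mul_nonneg (Real.sqrt_nonneg Q) hq.le, sq_nonneg (√Q), sq_nonneg q]
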